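/- The continuous sentence value ψ(m) := inf over x ∈ M_m(ℂ) with ‖x‖_OP ≤ 1 of max(‖x*x − (x*x)²‖_OP, ‖x*x + xx* − 1_m‖_OP) equals 0 when m is even and is bounded below by a positive constant (independent of m) when m is odd. -/

import Mathlib

open Matrix


/-- Euclidean norm of a complex `m`-vector. -/
noncomputable def vecNorm {m : ℕ} (ξ : Fin m → ℂ) : ℝ :=
  Real.sqrt (∑ i, ‖ξ i‖ ^ 2)

/-- Operator norm of an `m × m` complex matrix:
the supremum of `‖a ξ‖` over unit vectors `ξ`. -/
noncomputable def opNorm {m : ℕ} (a : Matrix (Fin m) (Fin m) ℂ) : ℝ :=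
  sSup {r : ℝ | ∃ ξ : Fin m → ℂ, vecNorm ξ = 1 ∧ r = vecNorm (a.mulVec ξ)}

/-- Normalized Hilbert–Schmidt norm of an `m × m` complex matrix. -/
noncomputable def hsNorm {m : ℕ} (a : Matrix (Fin m) (Fin m) ℂ) : ℝ :=
  Real.sqrt ((1 / (m : ℝ)) * ∑ i, ∑ j, ‖a i j‖ ^ 2)

open scoped Matrix.Norms.L2Operator in
lemma opNorm_eq_l2 {m : ℕ} (a : Matrix (Fin m) (Fin m) ℂ) : opNorm a = ‖a‖ := by
  have hv : ∀ ξ : Fin m → ℂ, vecNorm ξ = ‖WithLp.toLp 2 ξ‖ := by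
    intro ξ
    rw [EuclideanSpace.norm_eq]; rfl
  have hb : ∀ ξ : Fin m → ℂ, vecNorm ξ = 1 → vecNorm (a.mulVec ξ) ≤ ‖a‖ := by
    intro ξ h
    have := Matrix.l2_opNorm_mulVec a (WithLp.toLp 2 ξ)
    rw [← hv ξ, h, mul_one] at this
    rw [hv]
    exact this
  have hn : 0 ≤ opNorm a := by
    apply Real.sSup_nonneg
    rintro r ⟨ξ, -, rfl⟩
    exact Real.sqrt_nonneg _
  apply le_antisymm
  · apply Real.sSup_le _ (norm_nonneg _)
    rintro r ⟨ξ, h, rfl⟩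
    exact hb ξ h
  · rw [Matrix.l2_opNorm_def]
    apply ContinuousLinearMap.opNorm_le_of_unit_norm hn
    intro v hv1
    apply le_csSup
    · refine ⟨‖a‖, ?_⟩
      rintro r ⟨ξ, h, rfl⟩
      exact hb ξ h
    · refine ⟨v.ofLp, ?_, ?_⟩
      · rw [hv]; exact hv1
      · rw [hv]; rfl

open scoped Matrix.Norms.L2Operator in
lemma odd_lower {m : ℕ} (hm : Odd m) (x : Matrix (Fin m) (Fin m) ℂ) (hx : ‖x‖ ≤ 1)
    (h1 : ‖xᴴ * x - (xᴴ * x) * (xᴴ * x)‖ < 1 / 20)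
    (h2 : ‖xᴴ * x + x * xᴴ - 1‖ < 1 / 20) : False := by
  have : Nonempty (Fin m) := ⟨⟨0, hm.pos⟩⟩
  set a := xᴴ * x with ha
  set b := x * xᴴ with hb
  have haH : aᴴ = a := by simp [ha]
  have hbH : bᴴ = b := by simp [hb]
  have hna : ‖a‖ ≤ 1 := by
    rw [ha, Matrix.l2_opNorm_conjTranspose_mul_self]
    nlinarith [norm_nonneg x]
  have hn1 : ‖(1 : Matrix (Fin m) (Fin m) ℂ)‖ = 1 := CStarRing.norm_one
  let H : ℝ → Matrix (Fin m) (Fin m) ℂ := fun t => (1 - 2 • a) + ((2 * t : ℝ) : ℂ) • (a + b - 1)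
  have hHH : ∀ t, (H t)ᴴ = H t := by
    intro t
    simp only [H, conjTranspose_add, conjTranspose_sub, conjTranspose_smul, haH, hbH,
      conjTranspose_one, Complex.star_def, Complex.conj_ofReal, star_trivial]
  have hu : ∀ t ∈ Set.Icc (0 : ℝ) 1, (H t).det ≠ 0 := by
    intro t ht
    have e : H t * (1 - 2 • a) = 1 - (4 • (a - a * a) -
        ((2 * t : ℝ) : ℂ) • ((a + b - 1) * (1 - 2 • a))) := by
      simp only [H, add_mul, smul_mul_assoc]
      have : (1 - 2 • a) * (1 - 2 • a) = 1 - 4 • (a - a * a) := by noncomm_ring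
      rw [this]; abel
    have h3 : ‖1 - 2 • a‖ ≤ 3 := by
      calc ‖1 - 2 • a‖ ≤ ‖(1 : Matrix (Fin m) (Fin m) ℂ)‖ + ‖2 • a‖ := norm_sub_le _ _
        _ ≤ 1 + 2 * ‖a‖ := by
          rw [hn1]; gcongr; simpa using norm_nsmul_le (n := 2) (a := a)
        _ ≤ 3 := by linarith
    have h4 : ‖4 • (a - a * a) - ((2 * t : ℝ) : ℂ) • ((a + b - 1) * (1 - 2 • a))‖ < 1 := by
      have e1 : ‖4 • (a - a * a)‖ ≤ 4 * ‖a - a * a‖ := by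
        simpa using norm_nsmul_le (n := 4) (a := a - a * a)
      have e2 : ‖((2 * t : ℝ) : ℂ) • ((a + b - 1) * (1 - 2 • a))‖ ≤ 2 * (1 / 20 * 3) := by
        rw [norm_smul]
        have : ‖((2 * t : ℝ) : ℂ)‖ ≤ 2 := by
          rw [Complex.norm_real, Real.norm_eq_abs, abs_le]
          constructor <;> linarith [ht.1, ht.2]
        have e3 : ‖(a + b - 1) * (1 - 2 • a)‖ ≤ 1 / 20 * 3 :=
          (norm_mul_le _ _).trans (mul_le_mul h2.le h3 (norm_nonneg _) (by norm_num))
        exact mul_le_mul this e3 (norm_nonneg _) (by norm_num)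
      have := norm_sub_le (4 • (a - a * a)) (((2 * t : ℝ) : ℂ) • ((a + b - 1) * (1 - 2 • a)))
      linarith
    have h5 : IsUnit (H t * (1 - 2 • a)) := by
      rw [e]; exact isUnit_one_sub_of_norm_lt_one h4
    rw [Matrix.isUnit_iff_isUnit_det, det_mul] at h5
    exact left_ne_zero_of_mul h5.ne_zero
  have him : ∀ t, (H t).det.im = 0 := by
    intro t
    have := Matrix.det_conjTranspose (H t)
    rw [hHH] at this
    exact Complex.conj_eq_iff_im.1 this.symm
  have hre : ∀ t ∈ Set.Icc (0 : ℝ) 1, (H t).det.re ≠ 0 := fun t ht h =>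
    hu t ht (Complex.ext h (him t))
  have hc : Continuous fun t => (H t).det.re := by
    apply Complex.continuous_re.comp
    apply Continuous.matrix_det
    simp only [H]
    fun_prop
  have hend : (H 1).det = - (H 0).det := by
    have e0 : (H 0).det = (1 - 2 • b).det := by
      have := Matrix.det_one_sub_mul_comm (2 • xᴴ) x
      rw [smul_mul_assoc, mul_smul_comm] at this
      rw [ha, hb] at *
      simpa only [H, mul_zero, Complex.ofReal_zero, zero_smul, add_zero] using this
    have e1 : H 1 = -(1 - 2 • b) := by
      simp only [H, mul_one, Complex.ofReal_ofNat, ofNat_smul_eq_nsmul]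
      rw [two_smul, two_smul, two_smul]; abel
    rw [e0, e1, Matrix.det_neg, Fintype.card_fin, hm.neg_one_pow, neg_one_mul]
  have hend' : (H 1).det.re = - (H 0).det.re := by rw [hend]; rfl
  have h01 : (0 : ℝ) ≤ 1 := zero_le_one
  rcases le_total 0 (H 0).det.re with h | h
  · obtain ⟨t, ht, h0⟩ := intermediate_value_Icc' h01 hc.continuousOn
      (show (0 : ℝ) ∈ Set.Icc _ _ from ⟨by simp only [hend']; linarith, h⟩)
    exact hre t ht h0
  · obtain ⟨t, ht, h0⟩ := intermediate_value_Icc h01 hc.continuousOn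
      (show (0 : ℝ) ∈ Set.Icc _ _ from ⟨h, by simp only [hend']; linarith⟩)
    exact hre t ht h0

lemma even_witness (k : ℕ) : ∃ x : Matrix (Fin (k + k)) (Fin (k + k)) ℂ,
    xᴴ * x = (xᴴ * x) * (xᴴ * x) ∧ xᴴ * x + x * xᴴ = 1 := by
  let y : Matrix (Fin k ⊕ Fin k) (Fin k ⊕ Fin k) ℂ := fromBlocks 0 0 1 0
  have h1 : yᴴ * y = fromBlocks 1 0 0 0 := by
    simp [y, fromBlocks_conjTranspose, fromBlocks_multiply]
  have h2 : y * yᴴ = fromBlocks 0 0 0 1 := by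
    simp [y, fromBlocks_conjTranspose, fromBlocks_multiply]
  refine ⟨y.submatrix finSumFinEquiv.symm finSumFinEquiv.symm, ?_, ?_⟩
  · rw [conjTranspose_submatrix, submatrix_mul_equiv, submatrix_mul_equiv, h1, fromBlocks_multiply]
    simp
  · rw [conjTranspose_submatrix, submatrix_mul_equiv, submatrix_mul_equiv, h1, h2]
    have e : (fromBlocks 1 0 0 0 + fromBlocks 0 0 0 1 :
        Matrix (Fin k ⊕ Fin k) (Fin k ⊕ Fin k) ℂ) = 1 := by
      rw [fromBlocks_add]; simp
    have esub := congrArg (fun z => z.submatrix finSumFinEquiv.symm finSumFinEquiv.symm) e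
    simp only [submatrix_one_equiv] at esub
    exact esub

open scoped Matrix.Norms.L2Operator in
/-- The value of the continuous sentence `ψ` in `M_m(ℂ)` is 0 for even `m` and is
bounded below by a positive constant independent of `m` for odd `m`. -/
theorem psi_even_zero_odd_bounded_below :
    ∃ c : ℝ, 0 < c ∧ ∀ m : ℕ,
      (Even m → sInf {r : ℝ | ∃ x : Matrix (Fin m) (Fin m) ℂ, opNorm x ≤ 1 ∧
          r = max (opNorm (xᴴ * x - (xᴴ * x) * (xᴴ * x)))
                  (opNorm (xᴴ * x + x * xᴴ - 1))} = 0) ∧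
      (Odd m → c ≤ sInf {r : ℝ | ∃ x : Matrix (Fin m) (Fin m) ℂ, opNorm x ≤ 1 ∧
          r = max (opNorm (xᴴ * x - (xᴴ * x) * (xᴴ * x)))
                  (opNorm (xᴴ * x + x * xᴴ - 1))}) := by
  refine ⟨1 / 20, by norm_num, fun m => ⟨?_, ?_⟩⟩
  · rintro ⟨k, rfl⟩
    simp only [opNorm_eq_l2]
    apply IsLeast.csInf_eq
    constructor
    · obtain ⟨x, h1, h2⟩ := even_witness k
      refine ⟨x, ?_, ?_⟩
      · have e1 : ‖xᴴ * x‖ = ‖x‖ * ‖x‖ := Matrix.l2_opNorm_conjTranspose_mul_self x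
        have e2 : ‖(xᴴ * x)ᴴ * (xᴴ * x)‖ = ‖xᴴ * x‖ * ‖xᴴ * x‖ :=
          Matrix.l2_opNorm_conjTranspose_mul_self _
        rw [conjTranspose_mul, conjTranspose_conjTranspose, ← h1, e1] at e2
        by_contra hlt
        push Not at hlt
        have h3 : 1 < ‖x‖ * ‖x‖ := by nlinarith
        nlinarith
      · rw [sub_eq_zero.2 h1, sub_eq_zero.2 h2]; simp
    · rintro r ⟨x, -, rfl⟩
      exact le_max_of_le_left (norm_nonneg _)
  · intro hm
    simp only [opNorm_eq_l2]
    apply le_csInf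
    · exact ⟨_, 0, by simp, rfl⟩
    · rintro r ⟨x, hx, rfl⟩
      by_contra hlt
      rw [not_le, max_lt_iff] at hlt
      exact odd_lower hm x hx hlt.1 hlt.2
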